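/- arXiv:2511.01037 — 5 statements merged into one kernel-verified Lean document; each statement's English description precedes it below -/
import Mathlib

section
/- For every c ∈ ℝ, a > 0, and b ∈ ℝ, 𝔼[e^{c|a·g + b|}] = (1/2)·e^{a²c²/2}·( e^{−cb}·erfc( −(c·a − b/a)/√2 ) + e^{cb}·erfc( −(c·a + b/a)/√2 ) ). -/
open Real MeasureTheory ProbabilityTheory

/-- The complementary error function `erfc x = (2/√π) ∫_x^∞ e^{-t²} dt`. -/
noncomputable def erfc (x : ℝ) : ℝ := (2 / Real.sqrt π) * ∫ t in Set.Ioi x, Real.exp (-t ^ 2)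

/-- A set integral against a nondegenerate Gaussian, as a Lebesgue integral. -/
lemma setIntegral_gaussianReal_eq_setIntegral_smul {E : Type*} [NormedAddCommGroup E]
    [NormedSpace ℝ E] {μ : ℝ} {v : NNReal} {f : ℝ → E} {s : Set ℝ} (hs : MeasurableSet s)
    (hv : v ≠ 0) :
    ∫ x in s, f x ∂(gaussianReal μ v) = ∫ x in s, gaussianPDFReal μ v x • f x := by
  rw [← integral_indicator hs, integral_gaussianReal_eq_integral_smul hv, ← integral_indicator hs]
  simp only [Set.indicator_smul_apply]

/-- The moment generating function of a standard Gaussian restricted to an upper half-line. -/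
lemma setIntegral_Ioi_exp_mul_gaussianReal (t s : ℝ) :
    ∫ x in Set.Ioi s, exp (t * x) ∂(gaussianReal 0 1) =
      (1 / 2) * exp (t ^ 2 / 2) * erfc (-((t - s) / √2)) := by
  have h2 : (0 : ℝ) < √2 := by positivity
  have hshift : ∫ x in Set.Ioi s, exp (-((√2)⁻¹ * (x - t)) ^ 2) =
      ∫ x in Set.Ioi (s - t), exp (-((√2)⁻¹ * x) ^ 2) := by
    have h := (measurePreserving_sub_right volume t).setIntegral_preimage_emb
      (measurableEmbedding_subRight t) (fun x ↦ exp (-((√2)⁻¹ * x) ^ 2)) (Set.Ioi (s - t))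
    simpa using h
  have hscale := integral_comp_mul_left_Ioi (fun x : ℝ ↦ exp (-x ^ 2)) (s - t) (inv_pos.2 h2)
  have hbound : -((t - s) / √2) = (√2)⁻¹ * (s - t) := by ring
  have hdens (x : ℝ) : gaussianPDFReal 0 1 x • exp (t * x) =
      ((√(2 * π))⁻¹ * exp (t ^ 2 / 2)) * exp (-((√2)⁻¹ * (x - t)) ^ 2) := by
    simp only [gaussianPDFReal, smul_eq_mul, NNReal.coe_one, mul_one, mul_assoc, ← exp_add]
    congr 2
    rw [mul_pow, inv_pow, Real.sq_sqrt zero_le_two]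
    ring
  rw [setIntegral_gaussianReal_eq_setIntegral_smul measurableSet_Ioi one_ne_zero]
  simp_rw [hdens]
  rw [integral_const_mul, hshift, hscale, erfc, hbound, Real.sqrt_mul zero_le_two, inv_inv,
    smul_eq_mul]
  field_simp

/-- The moment generating function of a standard Gaussian restricted to a lower half-line. -/
lemma setIntegral_Iic_exp_mul_gaussianReal (t s : ℝ) :
    ∫ x in Set.Iic s, exp (t * x) ∂(gaussianReal 0 1) =
      (1 / 2) * exp (t ^ 2 / 2) * erfc ((t - s) / √2) := by
  have h := setIntegral_Ioi_exp_mul_gaussianReal (-t) (-s)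
  rw [setIntegral_gaussianReal_eq_setIntegral_smul measurableSet_Ioi one_ne_zero] at h
  rw [setIntegral_gaussianReal_eq_setIntegral_smul measurableSet_Iic one_ne_zero,
    ← neg_neg s, ← integral_comp_neg_Ioi]
  convert h using 1
  · simp [gaussianPDFReal]
  · rw [neg_sq]
    congr 2
    ring

/-- For every `c ∈ ℝ`, `a > 0`, `b ∈ ℝ`,
`𝔼[e^{c|a g + b|}] = (1/2) e^{a²c²/2} (e^{-cb} erfc(-(ca - b/a)/√2) + e^{cb} erfc(-(ca + b/a)/√2))`
where `g` is a standard Gaussian. -/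
theorem mgf_abs_gaussian (c a b : ℝ) (ha : 0 < a) :
    (∫ g, Real.exp (c * |a * g + b|) ∂(gaussianReal 0 1)) =
      (1 / 2) * Real.exp (a ^ 2 * c ^ 2 / 2) *
        (Real.exp (-(c * b)) * erfc (-((c * a - b / a) / Real.sqrt 2)) +
          Real.exp (c * b) * erfc (-((c * a + b / a) / Real.sqrt 2))) := by
  have hint (t : ℝ) : Integrable (fun g ↦ exp (t * (a * g + b))) (gaussianReal 0 1) := by
    simp_rw [mul_add, exp_add, ← mul_assoc]
    exact (integrable_exp_mul_gaussianReal (t * a)).mul_const _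
  rw [← integral_add_compl measurableSet_Ioi (integrable_exp_mul_abs (hint c) (hint (-c)))
    (s := Set.Ioi (-b / a)), Set.compl_Ioi]
  have hIoi : ∫ g in Set.Ioi (-b / a), exp (c * |a * g + b|) ∂(gaussianReal 0 1) =
      ∫ g in Set.Ioi (-b / a), exp (c * b) * exp (c * a * g) ∂(gaussianReal 0 1) := by
    refine setIntegral_congr_fun measurableSet_Ioi fun g hg ↦ ?_
    have hpos : -b < g * a := (div_lt_iff₀ ha).1 hg
    simp only [← exp_add]
    rw [abs_of_nonneg (by linarith)]
    ring_nf
  have hIic : ∫ g in Set.Iic (-b / a), exp (c * |a * g + b|) ∂(gaussianReal 0 1) =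
      ∫ g in Set.Iic (-b / a), exp (-(c * b)) * exp (-(c * a) * g) ∂(gaussianReal 0 1) := by
    refine setIntegral_congr_fun measurableSet_Iic fun g hg ↦ ?_
    have hneg : g * a ≤ -b := (le_div_iff₀ ha).1 hg
    simp only [← exp_add]
    rw [abs_of_nonpos (by linarith)]
    ring_nf
  rw [hIoi, hIic, integral_const_mul, integral_const_mul, setIntegral_Ioi_exp_mul_gaussianReal,
    setIntegral_Iic_exp_mul_gaussianReal]
  have hsq : (c * a) ^ 2 = a ^ 2 * c ^ 2 := by ring
  have hplus : c * a - -b / a = c * a + b / a := by ring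
  have hminus : (-(c * a) - -b / a) / √2 = -((c * a - b / a) / √2) := by ring
  rw [neg_sq, hsq, hplus, hminus]
  ring
end

section
/- For every B > 0, σ > 0, and C ∈ ℝ, 𝔼[e^{−B·max(σ·g + C, 0)²}] = ( e^{−BC²/(2σ²B + 1)} / (2·√(2σ²B + 1)) )·erfc( (−C/σ)/√(4σ²B + 2) ) + (1/2)·erfc( C/(√2·σ) ). -/
open Real MeasureTheory ProbabilityTheory

theorem integral_Ioi_exp_neg_affine_sq {a : ℝ} (ha : 0 < a) (b c : ℝ) :
    ∫ x in Set.Ioi c, Real.exp (-(a * x + b) ^ 2) =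
      Real.sqrt π / (2 * a) * erfc (a * c + b) := by
  have hshift : ∫ x in Set.Ioi (a * c), Real.exp (-(x + b) ^ 2) =
      ∫ x in Set.Ioi (a * c + b), Real.exp (-x ^ 2) := by
    have h := (measurePreserving_add_right volume b).setIntegral_preimage_emb
      (measurableEmbedding_addRight b) (fun x : ℝ => Real.exp (-x ^ 2)) (Set.Ioi (a * c + b))
    rw [← h]
    simp
  have hscale := integral_comp_mul_left_Ioi (fun x => Real.exp (-(x + b) ^ 2)) c ha
  simp only [smul_eq_mul] at hscale
  rw [hscale, hshift, erfc]
  have hpi : Real.sqrt π ≠ 0 := (Real.sqrt_pos.2 pi_pos).ne'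
  field_simp

theorem integral_Iic_exp_neg_mul_sq {a : ℝ} (ha : 0 < a) (c : ℝ) :
    ∫ x in Set.Iic c, Real.exp (-(a * x) ^ 2) =
      Real.sqrt π / (2 * a) * erfc (-(a * c)) := by
  have h := integral_comp_neg_Iic c (fun x => Real.exp (-(a * x) ^ 2))
  have h' := integral_Ioi_exp_neg_affine_sq ha 0 (-c)
  simp only [mul_neg, neg_sq, add_zero] at h h'
  rw [h, h']

/-- For every `B > 0`, `σ > 0`, `C ∈ ℝ`,
`𝔼[e^{-B max(σ g + C, 0)²}] = (e^{-BC²/(2σ²B+1)}/(2√(2σ²B+1))) erfc((-C/σ)/√(4σ²B+2))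
+ (1/2) erfc(C/(√2 σ))` where `g` is a standard Gaussian. -/
theorem gaussian_exp_neg_posPart_sq (B σ C : ℝ) (hB : 0 < B) (hσ : 0 < σ) :
    (∫ g, Real.exp (-B * max (σ * g + C) 0 ^ 2) ∂(gaussianReal 0 1)) =
      Real.exp (-B * C ^ 2 / (2 * σ ^ 2 * B + 1)) / (2 * Real.sqrt (2 * σ ^ 2 * B + 1)) *
          erfc ((-C / σ) / Real.sqrt (4 * σ ^ 2 * B + 2)) +
        (1 / 2) * erfc (C / (Real.sqrt 2 * σ)) := by
  set A : ℝ := 2 * σ ^ 2 * B + 1 with hA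
  have hA0 : 0 < A := by positivity
  have hs2 : 0 < Real.sqrt 2 := by positivity
  have hsA : 0 < Real.sqrt A := Real.sqrt_pos.2 hA0
  have hspi : 0 < Real.sqrt π := Real.sqrt_pos.2 pi_pos
  have hs2sq : Real.sqrt 2 ^ 2 = 2 := Real.sq_sqrt (by norm_num)
  have hsAsq : Real.sqrt A ^ 2 = A := Real.sq_sqrt hA0.le
  have hroot : Real.sqrt (4 * σ ^ 2 * B + 2) = Real.sqrt 2 * Real.sqrt A := by
    rw [← Real.sqrt_mul (by norm_num)]
    congr 1
    rw [hA]
    ring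
  have hint : Integrable (fun g =>
      Real.exp (-B * max (σ * g + C) 0 ^ 2) * Real.exp (-(1 / 2) * g ^ 2)) := by
    refine (integrable_exp_neg_mul_sq (b := 1 / 2) (by norm_num)).bdd_mul (c := 1) ?_ ?_
    · exact (by fun_prop : Continuous fun g : ℝ =>
        Real.exp (-B * max (σ * g + C) 0 ^ 2)).aestronglyMeasurable
    · refine Filter.Eventually.of_forall fun g => ?_
      rw [Real.norm_eq_abs, Real.abs_exp, Real.exp_le_one_iff, neg_mul]
      exact neg_nonpos.2 (by positivity)
  have hright : ∫ g in Set.Ioi (-C / σ),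
      Real.exp (-B * max (σ * g + C) 0 ^ 2) * Real.exp (-(1 / 2) * g ^ 2) =
      Real.exp (-B * C ^ 2 / A) *
        (Real.sqrt π / (2 * (Real.sqrt A / Real.sqrt 2)) *
          erfc ((-C / σ) / Real.sqrt (4 * σ ^ 2 * B + 2))) := by
    have harg : (-C / σ) / Real.sqrt (4 * σ ^ 2 * B + 2) =
        Real.sqrt A / Real.sqrt 2 * (-C / σ) +
          2 * B * σ * C / (Real.sqrt A * Real.sqrt 2) := by
      rw [hroot]
      field_simp
      rw [hsAsq, hA]
      ring
    rw [harg, ← integral_Ioi_exp_neg_affine_sq (by positivity), ← integral_const_mul]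
    refine setIntegral_congr_fun measurableSet_Ioi fun g hg => ?_
    have hg' : 0 ≤ σ * g + C := by
      have := (div_lt_iff₀ hσ).1 hg
      linarith
    rw [max_eq_left hg', ← Real.exp_add, ← Real.exp_add]
    congr 1
    have hsq : (Real.sqrt A / Real.sqrt 2 * g +
        2 * B * σ * C / (Real.sqrt A * Real.sqrt 2)) ^ 2 =
        A / 2 * g ^ 2 + 2 * B * σ * C * g + 2 * B ^ 2 * σ ^ 2 * C ^ 2 / A := by
      have : Real.sqrt A / Real.sqrt 2 * g + 2 * B * σ * C / (Real.sqrt A * Real.sqrt 2) =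
          (A * g + 2 * B * σ * C) / (Real.sqrt A * Real.sqrt 2) := by
        field_simp
        rw [hsAsq]
        ring
      rw [this, div_pow, mul_pow, hsAsq, hs2sq]
      field_simp
      ring
    rw [hsq]
    field_simp
    rw [hA]
    ring
  have hleft : ∫ g in Set.Iic (-C / σ),
      Real.exp (-B * max (σ * g + C) 0 ^ 2) * Real.exp (-(1 / 2) * g ^ 2) =
      Real.sqrt π / (2 * (1 / Real.sqrt 2)) * erfc (C / (Real.sqrt 2 * σ)) := by
    have harg : C / (Real.sqrt 2 * σ) = -(1 / Real.sqrt 2 * (-C / σ)) := by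
      field_simp
    rw [harg, ← integral_Iic_exp_neg_mul_sq (by positivity)]
    refine setIntegral_congr_fun measurableSet_Iic fun g hg => ?_
    have hg' : σ * g + C ≤ 0 := by
      have := (le_div_iff₀ hσ).1 hg
      linarith
    rw [max_eq_right hg', mul_pow, div_pow, hs2sq]
    simp
  have hdensity : ∀ g : ℝ, gaussianPDFReal 0 1 g • Real.exp (-B * max (σ * g + C) 0 ^ 2) =
      (Real.sqrt 2 * Real.sqrt π)⁻¹ *
        (Real.exp (-B * max (σ * g + C) 0 ^ 2) * Real.exp (-(1 / 2) * g ^ 2)) := by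
    intro g
    have hexp : -g ^ 2 / 2 = -(1 / 2) * g ^ 2 := by ring
    simp only [gaussianPDFReal, NNReal.coe_one, mul_one, sub_zero, smul_eq_mul, hexp]
    rw [Real.sqrt_mul (by norm_num)]
    ring
  rw [integral_gaussianReal_eq_integral_smul one_ne_zero]
  simp_rw [hdensity]
  rw [integral_const_mul, ← intervalIntegral.integral_Iic_add_Ioi hint.integrableOn
    hint.integrableOn (b := -C / σ), hleft, hright]
  field_simp
  ring
end

section
/- Fix q > 0 and h ∈ ℝ. Then lim_{c → ∞} e^{−(c² − q)/2}·𝔼_g[ exp( c·| √(1 − q/c²)·g + (√q·h)/c | ) ] = 2·cosh(√q·h), where the limit is taken over c > √q. -/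
open Real MeasureTheory ProbabilityTheory Filter

/-- For a standard Gaussian `g`, `𝔼_g[exp(t g + b)] = exp(t² / 2 + b)`. -/
lemma integral_exp_affine_gaussianReal (t b : ℝ) :
    ∫ g, Real.exp (t * g + b) ∂(gaussianReal 0 1) = Real.exp (t ^ 2 / 2 + b) := by
  have h := congrFun (mgf_fun_id_gaussianReal (μ := 0) (v := 1)) t
  simp only [mgf, zero_mul, NNReal.coe_one, one_mul, zero_add] at h
  simp_rw [Real.exp_add, integral_mul_const, h]

lemma integrable_exp_affine_gaussianReal (t b : ℝ) :
    Integrable (fun g => Real.exp (t * g + b)) (gaussianReal 0 1) := by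
  simp_rw [Real.exp_add]
  exact (integrable_exp_mul_gaussianReal t).mul_const _

lemma exp_abs_eq (x : ℝ) : Real.exp |x| = Real.exp x + Real.exp (-x) - Real.exp (-|x|) := by
  rcases abs_cases x with ⟨h, -⟩ | ⟨h, -⟩ <;> rw [h] <;> simp

lemma integrable_exp_neg_abs_affine_gaussianReal (t b : ℝ) :
    Integrable (fun g => Real.exp (-|t * g + b|)) (gaussianReal 0 1) := by
  refine Integrable.of_bound (by fun_prop) 1 (Eventually.of_forall fun g => ?_)
  simp

/-- For a standard Gaussian `g`, the expectation of `exp |t g + b|` is the sum of the two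
exponential moments, up to the bounded correction `𝔼_g[exp(-|t g + b|)]`. -/
lemma integral_exp_abs_affine_gaussianReal (t b : ℝ) :
    ∫ g, Real.exp |t * g + b| ∂(gaussianReal 0 1) =
      Real.exp (t ^ 2 / 2) * (2 * Real.cosh b) -
        ∫ g, Real.exp (-|t * g + b|) ∂(gaussianReal 0 1) := by
  have hneg : ∀ g, Real.exp (-(t * g + b)) = Real.exp (-t * g + -b) := fun g => by ring_nf
  simp_rw [exp_abs_eq (_ + b), hneg]
  have hsum : Integrable (fun g => Real.exp (t * g + b) + Real.exp (-t * g + -b))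
      (gaussianReal 0 1) :=
    (integrable_exp_affine_gaussianReal t b).add (integrable_exp_affine_gaussianReal (-t) (-b))
  rw [integral_sub hsum (integrable_exp_neg_abs_affine_gaussianReal t b),
    integral_add (integrable_exp_affine_gaussianReal t b)
      (integrable_exp_affine_gaussianReal (-t) (-b)),
    integral_exp_affine_gaussianReal, integral_exp_affine_gaussianReal, Real.cosh_eq,
    Real.exp_add, Real.exp_add, neg_sq]
  ring

lemma norm_integral_exp_neg_abs_affine_gaussianReal_le (t b : ℝ) :
    ‖∫ g, Real.exp (-|t * g + b|) ∂(gaussianReal 0 1)‖ ≤ 1 := by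
  have h := norm_integral_le_of_norm_le_const (μ := gaussianReal 0 1) (C := 1)
    (f := fun g => Real.exp (-|t * g + b|)) (Eventually.of_forall fun g => by simp)
  simpa using h

/-- Fix `q > 0` and `h ∈ ℝ`. Then, as `c → ∞` over `c > √q`,
`e^{-(c² - q)/2} 𝔼_g[exp(c |√(1 - q/c²) g + √q h / c|)] → 2 cosh(√q h)`
where `g` is a standard Gaussian. -/
theorem second_level_binary_inner_limit (q h : ℝ) (hq : 0 < q) :
    Tendsto (fun c : ℝ =>
        Real.exp (-(c ^ 2 - q) / 2) *
          ∫ g, Real.exp (c * |Real.sqrt (1 - q / c ^ 2) * g + Real.sqrt q * h / c|)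
            ∂(gaussianReal 0 1))
      (atTop ⊓ Filter.principal (Set.Ioi (Real.sqrt q)))
      (nhds (2 * Real.cosh (Real.sqrt q * h))) := by
  have hlim : Tendsto (fun c : ℝ => Real.exp (-(c ^ 2 - q) / 2)) atTop (nhds 0) := by
    refine Real.tendsto_exp_atBot.comp ?_
    refine Tendsto.atBot_div_const two_pos (tendsto_neg_atTop_atBot.comp ?_)
    exact tendsto_atTop_add_const_right _ (-q) (tendsto_pow_atTop two_ne_zero)
  have hrem : Tendsto (fun c : ℝ => Real.exp (-(c ^ 2 - q) / 2) *
      ∫ g, Real.exp (-|c * Real.sqrt (1 - q / c ^ 2) * g + Real.sqrt q * h|)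
        ∂(gaussianReal 0 1)) atTop (nhds 0) := by
    refine squeeze_zero_norm (fun c => ?_) hlim
    rw [norm_mul, Real.norm_of_nonneg (Real.exp_nonneg _)]
    exact mul_le_of_le_one_right (Real.exp_nonneg _)
      (norm_integral_exp_neg_abs_affine_gaussianReal_le _ _)
  have hmain := (hrem.const_sub (2 * Real.cosh (Real.sqrt q * h))).mono_left
    (inf_le_left : atTop ⊓ Filter.principal (Set.Ioi (Real.sqrt q)) ≤ atTop)
  rw [sub_zero] at hmain
  refine hmain.congr' ?_
  filter_upwards [mem_inf_of_right (mem_principal_self (Set.Ioi (Real.sqrt q)))] with c hc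
  have hc0 : 0 < c := (Real.sqrt_nonneg q).trans_lt hc
  have hqc : q < c ^ 2 := (Real.sqrt_lt' hc0).1 hc
  have habs : ∀ g, c * |Real.sqrt (1 - q / c ^ 2) * g + Real.sqrt q * h / c| =
      |c * Real.sqrt (1 - q / c ^ 2) * g + Real.sqrt q * h| := fun g => by
    rw [← abs_of_pos hc0, ← abs_mul, abs_of_pos hc0]
    congr 1
    field_simp
  have hsq : (c * Real.sqrt (1 - q / c ^ 2)) ^ 2 = c ^ 2 - q := by
    rw [mul_pow, Real.sq_sqrt (sub_nonneg.2 ((div_le_one (by positivity)).2 hqc.le))]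
    field_simp
  simp_rw [habs]
  rw [integral_exp_abs_affine_gaussianReal, hsq, mul_sub, ← mul_assoc, ← Real.exp_add,
    show -(c ^ 2 - q) / 2 + (c ^ 2 - q) / 2 = 0 by ring, Real.exp_zero, one_mul]
end

section
/- Let X and Y be nonempty finite sets and f : X × Y → ℝ. Then lim_{β → ∞} (1/β)·log( ∑_{x ∈ X} ( ∑_{y ∈ Y} e^{β·f(x,y)} )^{−1} ) = −min_{x ∈ X} max_{y ∈ Y} f(x, y). -/
open Real Filter

/-- A function bounded above and below by positive multiples of `exp (β * a)` has exponential
growth rate `a`. -/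
theorem tendsto_one_div_mul_log_of_exp_bounds {g : ℝ → ℝ} {a c C : ℝ} (hc : 0 < c)
    (hlower : ∀ β, 0 < β → c * Real.exp (β * a) ≤ g β)
    (hupper : ∀ β, 0 < β → g β ≤ C * Real.exp (β * a)) :
    Tendsto (fun β : ℝ => (1 / β) * Real.log (g β)) atTop (nhds a) := by
  have hC : 0 < C := by
    have h := (mul_pos hc (Real.exp_pos (1 * a))).trans_le
      ((hlower 1 one_pos).trans (hupper 1 one_pos))
    exact pos_of_mul_pos_left h (Real.exp_pos _).le
  have hlim (d : ℝ) : Tendsto (fun β : ℝ => d / β + a) atTop (nhds a) := by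
    simpa using (tendsto_const_nhds.div_atTop tendsto_id : Tendsto (fun β : ℝ => d / β)
      atTop (nhds 0)).add_const a
  have hlog {d β : ℝ} (hd : 0 < d) (hβ : 0 < β) :
      Real.log d / β + a = (1 / β) * Real.log (d * Real.exp (β * a)) := by
    rw [Real.log_mul hd.ne' (Real.exp_pos _).ne', Real.log_exp]
    field_simp
  refine tendsto_of_tendsto_of_tendsto_of_le_of_le' (hlim (Real.log c)) (hlim (Real.log C)) ?_ ?_
  · filter_upwards [eventually_gt_atTop 0] with β hβ
    rw [hlog hc hβ]
    have hpos : 0 < c * Real.exp (β * a) := by positivity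
    gcongr
    exact hlower β hβ
  · filter_upwards [eventually_gt_atTop 0] with β hβ
    rw [hlog hC hβ]
    have hpos : 0 < g β := (by positivity : 0 < c * Real.exp (β * a)).trans_le (hlower β hβ)
    gcongr
    exact hupper β hβ

theorem exp_mul_iSup_le_sum_exp {Y : Type*} [Fintype Y] [Nonempty Y] (g : Y → ℝ) (β : ℝ) :
    Real.exp (β * ⨆ y, g y) ≤ ∑ y, Real.exp (β * g y) := by
  obtain ⟨y, hy⟩ := exists_eq_ciSup_of_finite (f := g)
  rw [← hy]
  exact Finset.single_le_sum (f := fun y => Real.exp (β * g y))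
    (fun _ _ => (Real.exp_pos _).le) (Finset.mem_univ y)

theorem sum_exp_le_card_mul_exp_mul_iSup {Y : Type*} [Fintype Y] (g : Y → ℝ) {β : ℝ}
    (hβ : 0 ≤ β) :
    ∑ y, Real.exp (β * g y) ≤ Fintype.card Y * Real.exp (β * ⨆ y, g y) := by
  have h := Finset.sum_le_card_nsmul Finset.univ (fun y => Real.exp (β * g y))
    (Real.exp (β * ⨆ y, g y)) fun y _ => by
      gcongr
      exact le_ciSup (Set.finite_range g).bddAbove y
  simpa using h

/-- For nonempty finite sets `X`, `Y` and `f : X × Y → ℝ`,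
`lim_{β → ∞} (1/β) log(∑_{x ∈ X} (∑_{y ∈ Y} e^{β f(x,y)})⁻¹) = -min_x max_y f(x,y)`. -/
theorem ground_state_reciprocal_partition {X Y : Type*} [Fintype X] [Fintype Y]
    [Nonempty X] [Nonempty Y] (f : X → Y → ℝ) :
    Tendsto (fun β : ℝ =>
        (1 / β) * Real.log (∑ x : X, (∑ y : Y, Real.exp (β * f x y))⁻¹))
      atTop (nhds (-(⨅ x : X, ⨆ y : Y, f x y))) := by
  have hZ (β : ℝ) (x : X) : 0 < ∑ y, Real.exp (β * f x y) :=
    Finset.sum_pos (fun _ _ => Real.exp_pos _) Finset.univ_nonempty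
  refine tendsto_one_div_mul_log_of_exp_bounds (c := (Fintype.card Y : ℝ)⁻¹)
    (C := Fintype.card X) (by positivity) (fun β hβ => ?_) (fun β hβ => ?_)
  · obtain ⟨x, hx⟩ := exists_eq_ciInf_of_finite (f := fun x => ⨆ y, f x y)
    rw [← hx, mul_neg, Real.exp_neg, ← mul_inv]
    calc _ ≤ (∑ y, Real.exp (β * f x y))⁻¹ :=
          inv_anti₀ (hZ β x) (sum_exp_le_card_mul_exp_mul_iSup (f x) hβ.le)
      _ ≤ _ := Finset.single_le_sum (f := fun x => (∑ y, Real.exp (β * f x y))⁻¹)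
          (fun x _ => (inv_pos.2 (hZ β x)).le) (Finset.mem_univ x)
  · rw [mul_neg, Real.exp_neg]
    have h := Finset.sum_le_card_nsmul Finset.univ (fun x => (∑ y, Real.exp (β * f x y))⁻¹)
      (Real.exp (β * ⨅ x, ⨆ y, f x y))⁻¹ fun x _ => by
        refine inv_anti₀ (Real.exp_pos _) (le_trans ?_ (exp_mul_iSup_le_sum_exp (f x) β))
        gcongr
        exact ciInf_le (Set.finite_range fun x => ⨆ y, f x y).bddBelow x
    simpa using h
end

section
/- Fix p ∈ (0, 1) and κ ∈ ℝ, and let g and h be independent standard Gaussian random variables. Then lim_{B → ∞} 𝔼_h[ log 𝔼_g[ e^{−B·max( √(1−p)·g + √p·h + κ, 0 )²} ] ] = 𝔼_h[ log( (1/2)·erfc( (√p·h + κ)/√(2(1 − p)) ) ) ]. -/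
open Real MeasureTheory ProbabilityTheory Filter

/-- The lower tail of the standard Gaussian, in terms of `erfc`. -/
theorem gaussianReal_real_Iic_neg (c : ℝ) :
    (gaussianReal 0 1).real (Set.Iic (-c)) = 1 / 2 * erfc (c / √2) := by
  have hs : (0 : ℝ) < √2 := by positivity
  have hpi : (0 : ℝ) < √π := by positivity
  have hscale := integral_comp_mul_left_Ioi (fun t : ℝ => Real.exp (-t ^ 2)) c (inv_pos.2 hs)
  have hneg := integral_comp_neg_Iic (-c) (gaussianPDFReal 0 1)
  have hsymm : ∀ x, gaussianPDFReal 0 1 (-x) = gaussianPDFReal 0 1 x := by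
    simp [gaussianPDFReal]
  have hpdf : ∀ x, gaussianPDFReal 0 1 x = (√2 * √π)⁻¹ * Real.exp (-((√2)⁻¹ * x) ^ 2) := by
    intro x
    simp only [gaussianPDFReal, NNReal.coe_one, mul_one, sub_zero]
    rw [Real.sqrt_mul (by norm_num), mul_pow, inv_pow, Real.sq_sqrt (by norm_num)]
    congr 2
    ring
  simp only [hsymm, neg_neg] at hneg
  rw [measureReal_def, gaussianReal_apply_eq_integral _ one_ne_zero, ENNReal.toReal_ofReal
    (integral_nonneg fun x => gaussianPDFReal_nonneg _ _ _), hneg]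
  simp only [hpdf]
  rw [integral_const_mul, hscale, erfc, smul_eq_mul, inv_inv, inv_mul_eq_div]
  field_simp

/-- A Gaussian lower bound for the lower tail of the standard Gaussian. -/
theorem le_gaussianReal_real_Iic_neg (c : ℝ) :
    (√(2 * π))⁻¹ * Real.exp (-((|c| + 1) ^ 2 / 2)) ≤ (gaussianReal 0 1).real (Set.Iic (-c)) := by
  have hsub : Set.Icc (-|c| - 1) (-|c|) ⊆ Set.Iic (-c) := fun x hx =>
    hx.2.trans (neg_le_neg (le_abs_self c))
  refine le_trans ?_ (measureReal_mono hsub)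
  rw [measureReal_def, gaussianReal_apply_eq_integral _ one_ne_zero, ENNReal.toReal_ofReal
    (integral_nonneg fun x => gaussianPDFReal_nonneg _ _ _)]
  have hconst : ∫ _ in Set.Icc (-|c| - 1) (-|c|), (√(2 * π))⁻¹ * Real.exp (-((|c| + 1) ^ 2 / 2))
      = (√(2 * π))⁻¹ * Real.exp (-((|c| + 1) ^ 2 / 2)) := by
    simp [measureReal_def]
  rw [← hconst]
  refine setIntegral_mono_on (integrableOn_const (by simp)) (integrable_gaussianPDFReal 0 1).integrableOn
    measurableSet_Icc fun x hx => ?_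
  simp only [gaussianPDFReal, NNReal.coe_one, mul_one, sub_zero]
  gcongr
  rw [← neg_div]
  gcongr ?_ / 2
  have := abs_nonneg c
  nlinarith [hx.1, hx.2]

theorem tendsto_exp_neg_mul_max_sq (x : ℝ) :
    Tendsto (fun B : ℝ => Real.exp (-B * max x 0 ^ 2)) atTop
      (nhds ((Set.Iic (0 : ℝ)).indicator 1 x)) := by
  by_cases hx : x ≤ 0
  · simp [hx]
  · have hx' : 0 < x := not_le.1 hx
    rw [Set.indicator_of_notMem (by simpa using hx'), max_eq_left hx'.le]
    refine Real.tendsto_exp_atBot.comp ?_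
    exact tendsto_neg_atTop_atBot.atBot_mul_const (by positivity)

theorem exp_neg_mul_max_sq_le_one {B : ℝ} (hB : 0 ≤ B) (x : ℝ) :
    Real.exp (-B * max x 0 ^ 2) ≤ 1 := by
  rw [Real.exp_le_one_iff, neg_mul, neg_nonpos]
  positivity

theorem indicator_le_exp_neg_mul_max_sq (B x : ℝ) :
    (Set.Iic (0 : ℝ)).indicator 1 x ≤ Real.exp (-B * max x 0 ^ 2) := by
  by_cases hx : x ≤ 0
  · simp [hx]
  · rw [Set.indicator_of_notMem (by simpa using hx)]
    positivity

theorem integral_indicator_affine {a : ℝ} (ha : 0 < a) (b : ℝ) :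
    ∫ g, (Set.Iic (0 : ℝ)).indicator 1 (a * g + b) ∂(gaussianReal 0 1)
      = (gaussianReal 0 1).real (Set.Iic (-(b / a))) := by
  rw [← integral_indicator_one measurableSet_Iic]
  congr 1
  ext g
  have : a * g + b ≤ 0 ↔ g ≤ -(b / a) := by
    rw [← neg_div, le_div_iff₀ ha, mul_comm g]
    constructor <;> intro <;> linarith
  simp only [Set.indicator, Set.mem_Iic, this, Pi.one_apply]

theorem integrable_exp_neg_mul_max_sq {B : ℝ} (hB : 0 ≤ B) (a b : ℝ) :
    Integrable (fun g => Real.exp (-B * max (a * g + b) 0 ^ 2)) (gaussianReal 0 1) := by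
  refine Integrable.of_bound (by fun_prop) 1 (ae_of_all _ fun g => ?_)
  rw [Real.norm_of_nonneg (Real.exp_pos _).le]
  exact exp_neg_mul_max_sq_le_one hB _

theorem integrable_indicator_affine (a b : ℝ) :
    Integrable (fun g => (Set.Iic (0 : ℝ)).indicator (1 : ℝ → ℝ) (a * g + b))
      (gaussianReal 0 1) := by
  refine Integrable.of_bound ?_ 1 (ae_of_all _ fun g => ?_)
  · exact ((measurable_one.indicator measurableSet_Iic).comp
      (by fun_prop : Measurable fun g : ℝ => a * g + b)).aestronglyMeasurable
  · by_cases h : a * g + b ≤ 0 <;> simp [Set.indicator, h]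

theorem tendsto_integral_exp_neg_mul_max_sq {a : ℝ} (ha : 0 < a) (b : ℝ) :
    Tendsto (fun B : ℝ => ∫ g, Real.exp (-B * max (a * g + b) 0 ^ 2) ∂(gaussianReal 0 1))
      atTop (nhds ((gaussianReal 0 1).real (Set.Iic (-(b / a))))) := by
  rw [← integral_indicator_affine ha]
  refine tendsto_integral_filter_of_dominated_convergence (fun _ => 1)
    (Eventually.of_forall fun B => by fun_prop) ?_ (integrable_const _)
    (ae_of_all _ fun g => tendsto_exp_neg_mul_max_sq _)
  filter_upwards [eventually_ge_atTop 0] with B hB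
  refine ae_of_all _ fun g => ?_
  rw [Real.norm_of_nonneg (Real.exp_pos _).le]
  exact exp_neg_mul_max_sq_le_one hB _

theorem abs_log_integral_exp_neg_mul_max_sq_le {a B : ℝ} (ha : 0 < a) (hB : 0 ≤ B) (b : ℝ) :
    |Real.log (∫ g, Real.exp (-B * max (a * g + b) 0 ^ 2) ∂(gaussianReal 0 1))|
      ≤ (|b / a| + 1) ^ 2 / 2 + Real.log √(2 * π) := by
  have hlow : (√(2 * π))⁻¹ * Real.exp (-((|b / a| + 1) ^ 2 / 2))
      ≤ ∫ g, Real.exp (-B * max (a * g + b) 0 ^ 2) ∂(gaussianReal 0 1) := by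
    refine (le_gaussianReal_real_Iic_neg (b / a)).trans ?_
    rw [← integral_indicator_affine ha]
    exact integral_mono (integrable_indicator_affine a b) (integrable_exp_neg_mul_max_sq hB a b)
      fun g => indicator_le_exp_neg_mul_max_sq _ _
  have hup : ∫ g, Real.exp (-B * max (a * g + b) 0 ^ 2) ∂(gaussianReal 0 1) ≤ 1 := by
    refine (integral_mono (integrable_exp_neg_mul_max_sq hB a b) (integrable_const 1)
      fun g => exp_neg_mul_max_sq_le_one hB _).trans ?_
    simp
  have hlog := Real.log_le_log (by positivity) hlow
  rw [Real.log_mul (by positivity) (by positivity), Real.log_exp, Real.log_inv] at hlog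
  rw [abs_of_nonpos (Real.log_nonpos (le_trans (by positivity) hlow) hup)]
  linarith

/-- Fix `p ∈ (0,1)` and `κ ∈ ℝ`; let `g`, `h` be independent standard
Gaussians. Then
`lim_{B → ∞} 𝔼_h[log 𝔼_g[e^{-B max(√(1-p) g + √p h + κ, 0)²}]]
  = 𝔼_h[log((1/2) erfc((√p h + κ)/√(2(1-p))))]`. -/
theorem second_level_sphere_side_limit (p κ : ℝ) (hp : p ∈ Set.Ioo (0 : ℝ) 1) :
    Tendsto (fun B : ℝ =>
        ∫ h, Real.log
          (∫ g, Real.exp (-B * max (Real.sqrt (1 - p) * g + Real.sqrt p * h + κ) 0 ^ 2)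
            ∂(gaussianReal 0 1)) ∂(gaussianReal 0 1))
      atTop
      (nhds (∫ h, Real.log
        ((1 / 2) * erfc ((Real.sqrt p * h + κ) / Real.sqrt (2 * (1 - p))))
        ∂(gaussianReal 0 1))) := by
  have ha : 0 < √(1 - p) := Real.sqrt_pos.2 (by linarith [hp.2])
  have htarget : ∀ h : ℝ, 1 / 2 * erfc ((√p * h + κ) / √(2 * (1 - p)))
      = (gaussianReal 0 1).real (Set.Iic (-((√p * h + κ) / √(1 - p)))) := fun h => by
    rw [gaussianReal_real_Iic_neg, div_div, mul_comm √(1 - p), ← Real.sqrt_mul (by norm_num)]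
  simp only [htarget, add_assoc]
  refine tendsto_integral_filter_of_dominated_convergence
    (fun h => (|(√p * h + κ) / √(1 - p)| + 1) ^ 2 / 2 + Real.log √(2 * π)) ?_ ?_ ?_ ?_
  · refine Eventually.of_forall fun B => Measurable.aestronglyMeasurable ?_
    refine Real.measurable_log.comp (StronglyMeasurable.measurable ?_)
    exact StronglyMeasurable.integral_prod_right (ν := gaussianReal 0 1)
      (f := fun h g => Real.exp (-B * max (√(1 - p) * g + (√p * h + κ)) 0 ^ 2))
      (Continuous.stronglyMeasurable (by fun_prop))
  · filter_upwards [eventually_ge_atTop 0] with B hB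
    exact ae_of_all _ fun h => abs_log_integral_exp_neg_mul_max_sq_le ha hB _
  · have hid : MemLp (fun h : ℝ => h) 2 (gaussianReal 0 1) :=
      memLp_id_gaussianReal 2
    have habs : MemLp (fun h : ℝ => |(√p * h + κ) / √(1 - p)| + 1) 2 (gaussianReal 0 1) := by
      simp only [div_eq_inv_mul]
      exact ((((hid.const_mul √p).add (memLp_const κ)).const_mul _).norm).add (memLp_const 1)
    exact (habs.integrable_sq.div_const 2).add (integrable_const _)
  · refine ae_of_all _ fun h => ?_
    have hpos := (show (0 : ℝ) < _ by positivity).trans_le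
      (le_gaussianReal_real_Iic_neg ((√p * h + κ) / √(1 - p)))
    exact (tendsto_integral_exp_neg_mul_max_sq ha _).log hpos.ne'
end
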